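/- arXiv:2001.04857 — 2 statements merged into one kernel-verified Lean document; each statement's English description precedes it below -/
import Mathlib

section
/- Let X be a connected uniformly locally finite graph and T ≤ X a leafless end-respecting subtree with separators. Then Z^suf_1(T,ℤ) ∩ 𝒞(X,ℤ) = 0 and Z^suf_1(T,ℤ₂) ∩ 𝒞(X,ℤ₂) = 0 (a 1-chain supported on the edges of T which is in Z^suf_1(T) and is a thin sum of circuits of X must be zero). Consequently, the inclusion induces injections Z^suf_1(T,ℤ) ↪ Z^suf_1(X,ℤ)/𝒞_∞(X,ℤ) and Z^suf_1(T,ℤ₂) ↪ Z^suf_1(X,ℤ₂)/𝒞_∞(X,ℤ₂); i.e., H^uf_1(T) embeds into H^uf_1(X) with coefficients in ℤ and in ℤ₂. -/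
open scoped Classical

namespace UFH

variable {V : Type}

/-- Uniform local finiteness: a uniform bound on vertex degrees. -/
def ULF (G : SimpleGraph V) : Prop :=
  ∃ D : ℕ, ∀ v : V, (G.neighborSet v).Finite ∧ (G.neighborSet v).ncard ≤ D

/-- An integer 1-chain: antisymmetric and supported on adjacent pairs. -/
def IsChain1 (G : SimpleGraph V) (f : V → V → ℤ) : Prop :=
  (∀ u v, f u v = - f v u) ∧ ∀ u v, f u v ≠ 0 → G.Adj u v

/-- A mod-2 1-chain: symmetric and supported on adjacent pairs. -/
def IsChain1Z2 (G : SimpleGraph V) (f : V → V → ZMod 2) : Prop :=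
  (∀ u v, f u v = f v u) ∧ ∀ u v, f u v ≠ 0 → G.Adj u v

/-- Divergence of an integer 1-chain at a vertex. -/
noncomputable def chainDiv (f : V → V → ℤ) (v : V) : ℤ := ∑ᶠ u, f u v

/-- Divergence of a mod-2 1-chain at a vertex. -/
noncomputable def chainDivZ2 (f : V → V → ZMod 2) (v : V) : ZMod 2 := ∑ᶠ u, f u v

def Bdd (f : V → V → ℤ) (C : ℕ) : Prop := ∀ u v, |f u v| ≤ (C : ℤ)

/-- The sup-norm of a bounded integer 1-chain (least uniform bound). -/
noncomputable def chainNorm (f : V → V → ℤ) : ℕ := sInf {C : ℕ | Bdd f C}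

/-- Bounded integer flows: bounded 1-chains with vanishing divergence everywhere. -/
def Zsuf1 (G : SimpleGraph V) : Set (V → V → ℤ) :=
  {f | IsChain1 G f ∧ (∃ C, Bdd f C) ∧ ∀ v, chainDiv f v = 0}

/-- Mod-2 cycles: mod-2 1-chains whose support meets every vertex evenly. -/
def Zsuf1Z2 (G : SimpleGraph V) : Set (V → V → ZMod 2) :=
  {f | IsChain1Z2 G f ∧ ∀ v, chainDivZ2 f v = 0}

/-- A circuit: a closed walk (based at some vertex). -/
abbrev Circuit (G : SimpleGraph V) := Σ v : V, G.Walk v v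

/-- Number of traversals of the oriented edge `(a, b)` by the walk `p`. -/
noncomputable def traversals {G : SimpleGraph V} {u v : V} (p : G.Walk u v) (a b : V) : ℕ :=
  ((Finset.range p.length).filter fun i => p.getVert i = a ∧ p.getVert (i + 1) = b).card

/-- The integer 1-chain of signed traversals of a walk. -/
noncomputable def walkChain {G : SimpleGraph V} {u v : V} (p : G.Walk u v) (a b : V) : ℤ :=
  (traversals p a b : ℤ) - (traversals p b a : ℤ)

/-- The mod-2 1-chain of traversals of a walk. -/
noncomputable def walkChainZ2 {G : SimpleGraph V} {u v : V} (p : G.Walk u v) (a b : V) : ZMod 2 :=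
  (traversals p a b : ZMod 2) + (traversals p b a : ZMod 2)

/-- The walk `p` passes through the edge `{a, b}`. -/
def OnWalk {G : SimpleGraph V} {u v : V} (p : G.Walk u v) (a b : V) : Prop :=
  ∃ i < p.length, (p.getVert i = a ∧ p.getVert (i + 1) = b) ∨
    (p.getVert i = b ∧ p.getVert (i + 1) = a)

/-- A coefficient family on circuits is thin (locally finite). -/
def ThinCoef (G : SimpleGraph V) (g : Circuit G → ℤ) : Prop :=
  ∀ a b : V, {c : Circuit G | g c ≠ 0 ∧ OnWalk c.2 a b}.Finite

def ThinCoefZ2 (G : SimpleGraph V) (g : Circuit G → ZMod 2) : Prop :=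
  ∀ a b : V, {c : Circuit G | g c ≠ 0 ∧ OnWalk c.2 a b}.Finite

/-- The 1-chain obtained as the (pointwise) sum of a family of circuits with coefficients. -/
noncomputable def circSum (G : SimpleGraph V) (g : Circuit G → ℤ) : V → V → ℤ :=
  fun a b => ∑ᶠ c : Circuit G, g c * walkChain c.2 a b

noncomputable def circSumZ2 (G : SimpleGraph V) (g : Circuit G → ZMod 2) : V → V → ZMod 2 :=
  fun a b => ∑ᶠ c : Circuit G, g c * walkChainZ2 c.2 a b

/-- 𝒞_r(X, ℤ): sums of circuits of length ≤ r with uniformly bounded integer coefficients. -/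
def Cr (G : SimpleGraph V) (r : ℕ) : Set (V → V → ℤ) :=
  {f | ∃ g : Circuit G → ℤ, (∃ C : ℕ, ∀ c, |g c| ≤ (C : ℤ)) ∧
    (∀ c, g c ≠ 0 → c.2.length ≤ r) ∧ ThinCoef G g ∧ f = circSum G g}

/-- 𝒞_∞(X, ℤ). -/
def Cinf (G : SimpleGraph V) : Set (V → V → ℤ) := ⋃ r : ℕ, Cr G r

/-- 𝒞(X, ℤ): thin sums of circuits with integer coefficients whose result is bounded. -/
def Cthin (G : SimpleGraph V) : Set (V → V → ℤ) :=
  {f | ∃ g : Circuit G → ℤ, ThinCoef G g ∧ (∃ C, Bdd f C) ∧ f = circSum G g}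

/-- 𝒞_r(X, ℤ₂). -/
def CrZ2 (G : SimpleGraph V) (r : ℕ) : Set (V → V → ZMod 2) :=
  {f | ∃ g : Circuit G → ZMod 2, (∀ c, g c ≠ 0 → c.2.length ≤ r) ∧
    ThinCoefZ2 G g ∧ f = circSumZ2 G g}

/-- 𝒞_∞(X, ℤ₂). -/
def CinfZ2 (G : SimpleGraph V) : Set (V → V → ZMod 2) := ⋃ r : ℕ, CrZ2 G r

/-- 𝒞(X, ℤ₂): thin sums of circuits mod 2. -/
def CthinZ2 (G : SimpleGraph V) : Set (V → V → ZMod 2) :=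
  {f | ∃ g : Circuit G → ZMod 2, ThinCoefZ2 G g ∧ f = circSumZ2 G g}

/-- `a` and `b` are joined by a walk avoiding the set `K`. -/
def ConnAvoiding (G : SimpleGraph V) (K : Set V) (a b : V) : Prop :=
  ∃ p : G.Walk a b, ∀ v ∈ p.support, v ∉ K

/-- A (one-sided infinite) ray in `G`. -/
def IsRay (G : SimpleGraph V) (x : ℕ → V) : Prop :=
  Function.Injective x ∧ ∀ n, G.Adj (x n) (x (n + 1))

/-- Two rays determine the same end. -/
def RayEquiv (G : SimpleGraph V) (x y : ℕ → V) : Prop :=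
  ∀ K : Finset V, ∃ N, ∀ n, N ≤ n → ∀ m, N ≤ m → ConnAvoiding G (↑K) (x n) (y m)

/-- The connected component of `v` in `X − K`. -/
def Component (G : SimpleGraph V) (K : Set V) (v : V) : Set V :=
  {u | u ∉ K ∧ ConnAvoiding G K u v}

def MoreThanOneEnd (G : SimpleGraph V) : Prop :=
  ∃ K : Finset V, ∃ v w : V, v ∉ K ∧ w ∉ K ∧ (Component G (↑K) v).Infinite ∧
    (Component G (↑K) w).Infinite ∧ ¬ ConnAvoiding G (↑K) v w

def OneEnded (G : SimpleGraph V) : Prop :=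
  Infinite V ∧ ∀ K : Finset V, ∃ v, v ∉ K ∧ (Component G (↑K) v).Infinite ∧
    ∀ u, u ∉ K → (Component G (↑K) u).Infinite → ConnAvoiding G (↑K) u v

/-- A bip: a bi-infinite path, i.e. injective graph morphism ℤ → T. -/
def IsBip (T : SimpleGraph V) (b : ℤ → V) : Prop :=
  Function.Injective b ∧ ∀ n : ℤ, T.Adj (b n) (b (n + 1))

/-- The bip `b` lies over the edge `{u, v}`. -/
def LiesOver (b : ℤ → V) (u v : V) : Prop :=
  ∃ n : ℤ, (b n = u ∧ b (n + 1) = v) ∨ (b n = v ∧ b (n + 1) = u)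

/-- The signed traversal of the oriented edge `(u, v)` by the bip `b`. -/
noncomputable def bipSign (b : ℤ → V) (u v : V) : ℤ :=
  if ∃ n : ℤ, b n = u ∧ b (n + 1) = v then 1
  else if ∃ n : ℤ, b n = v ∧ b (n + 1) = u then -1 else 0

noncomputable def bipOverZ2 (b : ℤ → V) (u v : V) : ZMod 2 :=
  if LiesOver b u v then 1 else 0

/-- `p` is the last bip of `P` (w.r.t. the order `r`) lying over the edge `{u, v}`. -/
def IsLast (P : Set (ℤ → V)) (r : (ℤ → V) → (ℤ → V) → Prop) (p : ℤ → V) (u v : V) : Prop :=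
  LiesOver p u v ∧ ∀ q ∈ P, q ≠ p → LiesOver q u v → r q p

/-- The 1-chain associated to coefficients on a family of bips. -/
noncomputable def bipMap (P : Set (ℤ → V)) (f : ↥P → ℤ) : V → V → ℤ :=
  fun u v => ∑ᶠ p : ↥P, f p * bipSign p.1 u v

noncomputable def bipMapZ2 (P : Set (ℤ → V)) (f : ↥P → ZMod 2) : V → V → ZMod 2 :=
  fun u v => ∑ᶠ p : ↥P, f p * bipOverZ2 p.1 u v

/-- The set `S` is connected in the graph `H` (walks staying inside `S`). -/
def ConnectedIn (H : SimpleGraph V) (S : Set V) : Prop :=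
  ∀ a ∈ S, ∀ b ∈ S, ∃ p : H.Walk a b, ∀ v ∈ p.support, v ∈ S

/-- `T` is a subtree of `G`. -/
def IsSubtree (G T : SimpleGraph V) : Prop :=
  T ≤ G ∧ T.IsAcyclic ∧ T.support.Nonempty ∧ ConnectedIn T T.support

/-- Every vertex of `T` has degree ≥ 2 in `T`. -/
def Leafless (T : SimpleGraph V) : Prop :=
  ∀ v ∈ T.support, ∃ u w : V, u ≠ w ∧ T.Adj v u ∧ T.Adj v w

/-- Distinct ends of `T` determine distinct ends of `G`. -/
def EndRespecting (G T : SimpleGraph V) : Prop :=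
  ∀ x y : ℕ → V, IsRay T x → IsRay T y → RayEquiv G x y → RayEquiv T x y

/-- Every end of `G` is represented by a unique end of `T`. -/
def EndDefining (G T : SimpleGraph V) : Prop :=
  EndRespecting G T ∧ ∀ x : ℕ → V, IsRay G x → ∃ y : ℕ → V, IsRay T y ∧ RayEquiv G x y

/-- The subtree `T` of `G` has separators. -/
def HasSeparators (G T : SimpleGraph V) : Prop :=
  ∃ K : ℕ → Finset V,
    (∀ n, K n ⊆ K (n + 1)) ∧
    (∀ v : V, ∃ n, v ∈ K n) ∧
    (∀ n, ConnectedIn G (↑(K n))) ∧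
    (∀ n, ConnectedIn T (T.support ∩ ↑(K n))) ∧
    (∀ n, ∀ v : V, v ∉ K n → (Component G (↑(K n)) v).Infinite →
      ∃! e : V × V, T.Adj e.1 e.2 ∧ e.1 ∈ K n ∧ e.2 ∉ K n ∧
        e.2 ∈ Component G (↑(K n)) v) ∧
    (∀ n, ∀ a b : V, T.Adj a b → a ∈ K n → b ∉ K n → (Component G (↑(K n)) b).Infinite)

/-- An integer 2-chain: alternating, supported on triangles. -/
def IsChain2 (G : SimpleGraph V) (g : V → V → V → ℤ) : Prop :=
  (∀ u v w, g u v w = - g v u w) ∧ (∀ u v w, g u v w = - g u w v) ∧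
    ∀ u v w, g u v w ≠ 0 → G.Adj u v ∧ G.Adj v w ∧ G.Adj u w

def Bdd2 (g : V → V → V → ℤ) (C : ℕ) : Prop := ∀ u v w, |g u v w| ≤ (C : ℤ)

/-- The boundary of a 2-chain. -/
noncomputable def bd2 (g : V → V → V → ℤ) : V → V → ℤ := fun u v => ∑ᶠ w, g u v w

/-- `H^suf_1`-expansion. -/
def HsufExp1 (G : SimpleGraph V) : Prop :=
  ∃ K : ℕ → ℕ, ∀ U : Finset V, ∀ f : V → V → ℤ,
    IsChain1 G f →
    (∀ u v, f u v ≠ 0 → u ∈ U ∧ v ∈ U) →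
    (∀ v ∈ U, (∀ u, G.Adj u v → u ∈ U) → chainDiv f v = 0) →
    (∃ fh ∈ Zsuf1 G, (∀ u ∈ U, ∀ v ∈ U, fh u v = f u v) ∧ chainNorm fh = chainNorm f) →
    ∃ g : V → V → V → ℤ, IsChain2 G g ∧ Bdd2 g (K (chainNorm f)) ∧
      ∀ u ∈ U, ∀ v ∈ U, bd2 g u v = f u v

/-- Pure `H^suf_1`-expansion. -/
def PureHsufExp1 (G : SimpleGraph V) : Prop :=
  ∃ K : ℕ → ℕ, ∀ U : Finset V, ∀ f : V → V → ℤ,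
    IsChain1 G f →
    (∀ u v, f u v ≠ 0 → u ∈ U ∧ v ∈ U) →
    (∀ v ∈ U, (∀ u, G.Adj u v → u ∈ U) → chainDiv f v = 0) →
    (∃ fh : V → V → ℤ, IsChain1 G fh ∧
        (∃ g2 : V → V → V → ℤ, IsChain2 G g2 ∧ (∃ C, Bdd2 g2 C) ∧ bd2 g2 = fh) ∧
        (∀ u ∈ U, ∀ v ∈ U, fh u v = f u v) ∧ chainNorm fh = chainNorm f) →
    ∃ g : V → V → V → ℤ, IsChain2 G g ∧ Bdd2 g (K (chainNorm f)) ∧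
      ∀ u ∈ U, ∀ v ∈ U, bd2 g u v = f u v

/-- The Rips graph of radius `s`. -/
def rips (G : SimpleGraph V) (s : ℕ) : SimpleGraph V :=
  SimpleGraph.fromRel fun u v => G.dist u v ≤ s

/-- Pure `H^uf_1`-expansion: the Rips graphs eventually have pure `H^suf_1`-expansion. -/
def PureHufExp1 (G : SimpleGraph V) : Prop := ∃ s₀ : ℕ, ∀ s, s₀ ≤ s → PureHsufExp1 (rips G s)

def VertexTransitive (G : SimpleGraph V) : Prop := ∀ u v : V, ∃ φ : G ≃g G, φ u = v

/-- The edge boundary of a finite set of vertices. -/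
def edgeBoundary (G : SimpleGraph V) (U : Finset V) : Set (Sym2 V) :=
  {e | e ∈ G.edgeSet ∧ ∃ a b : V, e = s(a, b) ∧ a ∈ U ∧ b ∉ U}

/-- Mod-2 reduction of an integer 1-chain. -/
def mod2 (f : V → V → ℤ) : V → V → ZMod 2 := fun u v => ((f u v : ℤ) : ZMod 2)

/-- Pointwise domination of 1-chains: `r` flows in the same direction as `φ`, no stronger. -/
def chainLE (r φ : V → V → ℤ) : Prop :=
  ∀ u v, (0 ≤ φ u v → 0 ≤ r u v ∧ r u v ≤ φ u v) ∧ (φ u v ≤ 0 → φ u v ≤ r u v ∧ r u v ≤ 0)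

/-- A set of functions is locally finite (thin). -/
def ThinFamily {Y : Type} (F : Set (Y → ZMod 2)) : Prop := ∀ y : Y, {f ∈ F | f y ≠ 0}.Finite

/-- The pointwise sum of a (thin) set of functions. -/
noncomputable def thinSum {Y : Type} (F : Set (Y → ZMod 2)) : Y → ZMod 2 :=
  fun y => ∑ᶠ f : ↥F, f.1 y

/-- A thin-sum space: a subspace closed under thin sums. -/
def IsThinSumSpace {Y : Type} (W : Set (Y → ZMod 2)) : Prop :=
  0 ∈ W ∧ (∀ f ∈ W, ∀ g ∈ W, f + g ∈ W) ∧ ∀ F ⊆ W, ThinFamily F → thinSum F ∈ W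

/-- A thin-sum basis for a thin-sum space. -/
def IsThinSumBasis {Y : Type} (A W : Set (Y → ZMod 2)) : Prop :=
  A ⊆ W ∧ (∀ f ∈ W, ∃ F ⊆ A, ThinFamily F ∧ f = thinSum F) ∧
    ∀ F ⊆ A, ThinFamily F → F.Nonempty → thinSum F ≠ 0

theorem sum_traversals {G : SimpleGraph V} {u v : V} (p : G.Walk u v) (P : Finset (V × V)) :
    ∑ e ∈ P, (traversals p e.1 e.2 : ℤ) =
      ∑ i ∈ Finset.range p.length, if (p.getVert i, p.getVert (i + 1)) ∈ P then 1 else 0 := by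
  simp only [traversals, Finset.card_filter, Nat.cast_sum, Nat.cast_ite, Nat.cast_one,
    Nat.cast_zero]
  rw [Finset.sum_comm]
  refine Finset.sum_congr rfl fun i _ => ?_
  rw [← Finset.sum_ite_eq' P (p.getVert i, p.getVert (i + 1)) fun _ => (1 : ℤ)]
  refine Finset.sum_congr rfl fun e _ => ?_
  simp only [Prod.ext_iff, eq_comm]

/-- A closed walk crosses a finite cut with total sign zero. -/
theorem sum_walkChain_cut {G : SimpleGraph V} {u : V} (p : G.Walk u u) (S : Set V)
    (P : Finset (V × V)) (hP : ∀ x y, (x, y) ∈ P ↔ G.Adj x y ∧ x ∈ S ∧ y ∉ S) :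
    ∑ e ∈ P, walkChain p e.1 e.2 = 0 := by
  have hswap : ∑ e ∈ P, (traversals p e.2 e.1 : ℤ) =
      ∑ e ∈ P.map (Equiv.prodComm V V).toEmbedding, (traversals p e.1 e.2 : ℤ) := by
    simp [Finset.sum_map]
  have hmem : ∀ x y, (x, y) ∈ P.map (Equiv.prodComm V V).toEmbedding ↔ (y, x) ∈ P := by
    intro x y
    simp
  simp only [walkChain, Finset.sum_sub_distrib]
  rw [hswap, sum_traversals, sum_traversals, ← Finset.sum_sub_distrib]
  have htel := Finset.sum_range_sub' (fun i => if p.getVert i ∈ S then (1 : ℤ) else 0) p.length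
  rw [SimpleGraph.Walk.getVert_zero, SimpleGraph.Walk.getVert_length, sub_self] at htel
  refine (Finset.sum_congr rfl fun i hi => ?_).trans htel
  have hadj := p.adj_getVert_succ (Finset.mem_range.1 hi)
  simp only [hmem, hP, hadj, hadj.symm, true_and]
  by_cases h₁ : p.getVert i ∈ S <;> by_cases h₂ : p.getVert (i + 1) ∈ S <;> simp [h₁, h₂]

theorem walkChain_eq_zero_of_not_onWalk {G : SimpleGraph V} {u v : V} (p : G.Walk u v) (a b : V)
    (h : ¬ OnWalk p a b) : walkChain p a b = 0 := by
  have h₁ : traversals p a b = 0 := by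
    rw [traversals, Finset.card_eq_zero, Finset.filter_eq_empty_iff]
    exact fun i hi hc => h ⟨i, Finset.mem_range.1 hi, Or.inl hc⟩
  have h₂ : traversals p b a = 0 := by
    rw [traversals, Finset.card_eq_zero, Finset.filter_eq_empty_iff]
    exact fun i hi hc => h ⟨i, Finset.mem_range.1 hi, Or.inr hc⟩
  simp [walkChain, h₁, h₂]

theorem walkChainZ2_eq_cast {G : SimpleGraph V} {u v : V} (p : G.Walk u v) (a b : V) :
    walkChainZ2 p a b = ((walkChain p a b : ℤ) : ZMod 2) := by
  simp [walkChain, walkChainZ2, CharTwo.sub_eq_add]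

/-- A thin sum of circuits sums to zero over every finite cut. -/
theorem sum_thin_circuits_cut {R : Type*} [CommRing R] {G : SimpleGraph V} (g : Circuit G → R)
    (hthin : ∀ a b : V, {c : Circuit G | g c ≠ 0 ∧ OnWalk c.2 a b}.Finite) (S : Set V)
    (P : Finset (V × V)) (hP : ∀ x y, (x, y) ∈ P ↔ G.Adj x y ∧ x ∈ S ∧ y ∉ S) :
    ∑ e ∈ P, ∑ᶠ c : Circuit G, g c * ((walkChain c.2 e.1 e.2 : ℤ) : R) = 0 := by
  rw [← finsum_sum_comm]
  · refine finsum_eq_zero_of_forall_eq_zero fun c => ?_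
    rw [← Finset.mul_sum, ← Int.cast_sum, sum_walkChain_cut c.2 S P hP, Int.cast_zero, mul_zero]
  · refine fun e _ => (hthin e.1 e.2).subset fun c hc => ?_
    refine ⟨left_ne_zero_of_mul hc, ?_⟩
    by_contra h
    exact hc (by simp [walkChain_eq_zero_of_not_onWalk c.2 e.1 e.2 h])

theorem ConnAvoiding.symm {G : SimpleGraph V} {K : Set V} {a b : V} (h : ConnAvoiding G K a b) :
    ConnAvoiding G K b a := by
  obtain ⟨p, hp⟩ := h
  exact ⟨p.reverse, by simpa using hp⟩

theorem ConnAvoiding.trans {G : SimpleGraph V} {K : Set V} {a b c : V}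
    (h : ConnAvoiding G K a b) (h' : ConnAvoiding G K b c) : ConnAvoiding G K a c := by
  obtain ⟨p, hp⟩ := h
  obtain ⟨q, hq⟩ := h'
  refine ⟨p.append q, fun v hv => ?_⟩
  rcases SimpleGraph.Walk.mem_support_append_iff p q |>.1 hv with hv | hv
  exacts [hp v hv, hq v hv]

theorem ConnAvoiding.refl {G : SimpleGraph V} {K : Set V} {a : V} (ha : a ∉ K) :
    ConnAvoiding G K a a :=
  ⟨.nil, by simpa using ha⟩

theorem connAvoiding_of_adj {G : SimpleGraph V} {K : Set V} {a b : V} (h : G.Adj a b)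
    (ha : a ∉ K) (hb : b ∉ K) : ConnAvoiding G K a b :=
  ⟨.cons h .nil, by simp [ha, hb]⟩

theorem component_eq_of_connAvoiding {G : SimpleGraph V} {K : Set V} {a b : V}
    (h : ConnAvoiding G K a b) : Component G K a = Component G K b := by
  ext u
  exact and_congr_right fun _ => ⟨fun hu => hu.trans h, fun hu => hu.trans h.symm⟩

theorem ULF.finite_incident {G : SimpleGraph V} (hulf : ULF G) (K : Finset V) :
    {e : V × V | G.Adj e.1 e.2 ∧ (e.1 ∈ K ∨ e.2 ∈ K)}.Finite := by
  obtain ⟨D, hD⟩ := hulf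
  have h₁ : (⋃ x ∈ K, (fun y => (x, y)) '' G.neighborSet x).Finite :=
    K.finite_toSet.biUnion fun x _ => (hD x).1.image _
  have h₂ : (⋃ x ∈ K, (fun y => (y, x)) '' G.neighborSet x).Finite :=
    K.finite_toSet.biUnion fun x _ => (hD x).1.image _
  refine (h₁.union h₂).subset ?_
  rintro ⟨x, y⟩ ⟨hxy, hx | hy⟩
  · left
    simp only [Set.mem_iUnion]
    exact ⟨x, hx, y, hxy, rfl⟩
  · right
    simp only [Set.mem_iUnion]
    exact ⟨y, hy, x, hxy.symm, rfl⟩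

/-- Every edge of an acyclic subgraph with separators is the only edge of that subgraph in some
finite cut of the ambient graph. -/
theorem exists_finite_cut_of_hasSeparators {G T : SimpleGraph V} (hulf : ULF G) (hle : T ≤ G)
    (hacyc : T.IsAcyclic) (hsep : HasSeparators G T) {a b : V} (hab : T.Adj a b) :
    ∃ (S : Set V) (P : Finset (V × V)), (∀ x y, (x, y) ∈ P ↔ G.Adj x y ∧ x ∈ S ∧ y ∉ S) ∧
      (a, b) ∈ P ∧ ∀ x y, (x, y) ∈ P → T.Adj x y → (x, y) = (a, b) := by
  obtain ⟨K, hmono, hex, -, -, huniq, hinf⟩ := hsep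
  obtain ⟨n, ha, hb⟩ : ∃ n, a ∈ K n ∧ b ∈ K n := by
    obtain ⟨i, hi⟩ := hex a
    obtain ⟨j, hj⟩ := hex b
    have hK : Monotone K := monotone_nat_of_le_succ hmono
    exact ⟨max i j, hK (le_max_left i j) hi, hK (le_max_right i j) hj⟩
  let A : Set V := {v | (T.deleteEdges {s(a, b)}).Reachable a v}
  have hbA : b ∉ A :=
    SimpleGraph.isBridge_iff.1 (SimpleGraph.isAcyclic_iff_forall_adj_isBridge.1 hacyc hab)
  have hA : ∀ x y, T.Adj x y → x ∈ A → y ∉ A → (x, y) = (a, b) := by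
    intro x y hxy hx hy
    by_cases he : s(x, y) = s(a, b)
    · rcases Sym2.eq_iff.1 he with ⟨rfl, rfl⟩ | ⟨rfl, rfl⟩
      · rfl
      · exact absurd hx hbA
    · refine absurd (SimpleGraph.Reachable.trans hx (SimpleGraph.Adj.reachable ?_)) hy
      simpa [SimpleGraph.deleteEdges_adj, hxy] using he
  let S : Set V := {v | (v ∈ K n ∧ v ∈ A) ∨ (v ∉ K n ∧ ∃ x y, T.Adj x y ∧ x ∈ K n ∧ y ∉ K n ∧
    y ∈ Component G (↑(K n)) v ∧ x ∈ A)}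
  have hSin : ∀ v ∈ K n, v ∈ S ↔ v ∈ A := by
    intro v hv
    simp [S, hv]
  have hSadj : ∀ x y, G.Adj x y → x ∉ K n → y ∉ K n → (x ∈ S ↔ y ∈ S) := by
    intro x y hxy hx hy
    have hc := component_eq_of_connAvoiding
      (connAvoiding_of_adj hxy (K := (↑(K n) : Set V)) (by simpa using hx) (by simpa using hy))
    simp [S, hx, hy, hc]
  have hSout : ∀ x y, T.Adj x y → x ∈ K n → y ∉ K n → (y ∈ S ↔ x ∈ A) := by
    intro x y hxy hx hy
    have hyy : y ∈ Component G (↑(K n)) y :=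
      ⟨by simpa using hy, .refl (by simpa using hy)⟩
    constructor
    · rintro (⟨h, -⟩ | ⟨-, x', y', h', hx', hy', hc, hA'⟩)
      · exact absurd h hy
      · have := (huniq n y hy (hinf n x y hxy hx hy)).unique
          (y₁ := (x, y)) (y₂ := (x', y')) ⟨hxy, hx, hy, hyy⟩ ⟨h', hx', hy', hc⟩
        exact (Prod.mk.inj this).1 ▸ hA'
    · exact fun h => Or.inr ⟨hy, x, y, hxy, hx, hy, hyy, h⟩
  have hfin : {e : V × V | G.Adj e.1 e.2 ∧ e.1 ∈ S ∧ e.2 ∉ S}.Finite := by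
    refine (hulf.finite_incident (K n)).subset fun e ⟨he, h₁, h₂⟩ => ⟨he, ?_⟩
    by_contra! h
    exact h₂ ((hSadj _ _ he h.1 h.2).1 h₁)
  refine ⟨S, hfin.toFinset, by simp, ?_, ?_⟩
  · simp [hle hab, hSin a ha, hSin b hb, hbA, A]
  · intro x y hP hxy
    simp only [Set.Finite.mem_toFinset, Set.mem_ofPred_eq] at hP
    obtain ⟨-, hx, hy⟩ := hP
    by_cases hxK : x ∈ K n <;> by_cases hyK : y ∈ K n
    · exact hA x y hxy ((hSin x hxK).1 hx) fun h => hy ((hSin y hyK).2 h)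
    · exact absurd ((hSout x y hxy hxK hyK).2 ((hSin x hxK).1 hx)) hy
    · exact absurd ((hSin y hyK).2 ((hSout y x hxy.symm hyK hxK).1 hx)) hy
    · exact absurd ((hSadj x y (hle hxy) hxK hyK).1 hx) hy

/-- A thin sum of circuits supported on an acyclic subgraph with separators vanishes. -/
theorem eq_zero_of_thin_circuits {R : Type*} [CommRing R] {G T : SimpleGraph V} (hulf : ULF G)
    (hle : T ≤ G) (hacyc : T.IsAcyclic) (hsep : HasSeparators G T) (g : Circuit G → R)
    (hthin : ∀ a b : V, {c : Circuit G | g c ≠ 0 ∧ OnWalk c.2 a b}.Finite) (f : V → V → R)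
    (hf : ∀ a b, f a b = ∑ᶠ c : Circuit G, g c * ((walkChain c.2 a b : ℤ) : R))
    (hsupp : ∀ u v, f u v ≠ 0 → T.Adj u v) : f = 0 := by
  funext a b
  by_contra hne
  obtain ⟨S, P, hP, hmem, honly⟩ :=
    exists_finite_cut_of_hasSeparators hulf hle hacyc hsep (hsupp a b hne)
  have hsum := sum_thin_circuits_cut g hthin S P hP
  simp only [← hf] at hsum
  rw [Finset.sum_eq_single_of_mem (a, b) hmem] at hsum
  · exact hne hsum
  · intro e he hab
    by_contra h
    exact hab (honly e.1 e.2 he (hsupp _ _ h))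

theorem adj_of_sub_ne_zero {R : Type*} [AddGroup R] {T : SimpleGraph V} {f g : V → V → R}
    (hf : ∀ u v, f u v ≠ 0 → T.Adj u v) (hg : ∀ u v, g u v ≠ 0 → T.Adj u v) (u v : V)
    (h : (f - g) u v ≠ 0) : T.Adj u v := by
  by_cases hfu : f u v = 0
  · refine hg u v fun hgu => h ?_
    simp [hfu, hgu]
  · exact hf u v hfu

/-- end-respecting trees with separators inject in first uniformly
finite homology, over ℤ and over ℤ₂. -/
theorem stmt4 (G T : SimpleGraph V) (hulf : ULF G) (hconn : G.Connected)
    (hsub : IsSubtree G T) (hleaf : Leafless T) (hresp : EndRespecting G T)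
    (hsep : HasSeparators G T) :
    (∀ f : V → V → ℤ, f ∈ Zsuf1 T → f ∈ Cthin G → f = 0) ∧
    (∀ f : V → V → ZMod 2, f ∈ Zsuf1Z2 T → f ∈ CthinZ2 G → f = 0) ∧
    (∀ f g : V → V → ℤ, f ∈ Zsuf1 T → g ∈ Zsuf1 T → f - g ∈ Cinf G → f = g) ∧
    (∀ f g : V → V → ZMod 2, f ∈ Zsuf1Z2 T → g ∈ Zsuf1Z2 T → f - g ∈ CinfZ2 G → f = g) := by
  obtain ⟨hle, hacyc, -, -⟩ := hsub
  have hℤ : ∀ (f : V → V → ℤ) (g : Circuit G → ℤ), (∀ u v, f u v ≠ 0 → T.Adj u v) →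
      ThinCoef G g → f = circSum G g → f = 0 := fun f g hsupp hthin hfg =>
    eq_zero_of_thin_circuits hulf hle hacyc hsep g hthin f
      (fun a b => by simp [hfg, circSum]) hsupp
  have hℤ₂ : ∀ (f : V → V → ZMod 2) (g : Circuit G → ZMod 2), (∀ u v, f u v ≠ 0 → T.Adj u v) →
      ThinCoefZ2 G g → f = circSumZ2 G g → f = 0 := fun f g hsupp hthin hfg =>
    eq_zero_of_thin_circuits hulf hle hacyc hsep g hthin f
      (fun a b => by simp [hfg, circSumZ2, walkChainZ2_eq_cast]) hsupp
  refine ⟨?_, ?_, ?_, ?_⟩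
  · rintro f hf ⟨g, hthin, -, hfg⟩
    exact hℤ f g hf.1.2 hthin hfg
  · rintro f hf ⟨g, hthin, hfg⟩
    exact hℤ₂ f g hf.1.2 hthin hfg
  · intro f f' hf hf' h
    obtain ⟨r, g, -, -, hthin, hfg⟩ := Set.mem_iUnion.1 h
    exact sub_eq_zero.1 (hℤ _ g (adj_of_sub_ne_zero hf.1.2 hf'.1.2) hthin hfg)
  · intro f f' hf hf' h
    obtain ⟨r, g, -, hthin, hfg⟩ := Set.mem_iUnion.1 h
    exact sub_eq_zero.1 (hℤ₂ _ g (adj_of_sub_ne_zero hf.1.2 hf'.1.2) hthin hfg)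

end UFH
end

section
/- Let X be a connected uniformly locally finite graph. The mod-2 reduction map (sending a bounded integer flow f to the ℤ₂-valued function on edges e ↦ f(e) mod 2, well defined since antisymmetry vanishes mod 2) is a surjection from Z^suf_1(X,ℤ) onto Z^suf_1(X,ℤ₂), and it maps 𝒞_∞(X,ℤ) into 𝒞_∞(X,ℤ₂). Consequently it induces a surjective group homomorphism Z^suf_1(X,ℤ)/𝒞_∞(X,ℤ) → Z^suf_1(X,ℤ₂)/𝒞_∞(X,ℤ₂); i.e., H^uf_1(X,ℤ₂) is a quotient of H^uf_1(X,ℤ). -/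
open scoped Classical

namespace UFH

variable {V : Type}

/-- A uniformly locally finite graph carries only finitely supported chains at each vertex. -/
lemma ULF.finite_support {A : Type*} [Zero A] {G : SimpleGraph V} (hulf : ULF G)
    {f : V → V → A} (hf : ∀ u v, f u v ≠ 0 → G.Adj u v) (v : V) :
    (Function.support fun u => f u v).Finite := by
  obtain ⟨D, hD⟩ := hulf
  exact (hD v).1.subset fun u hu => (hf u v hu).symm

/-- A finite set of even cardinality is the support of an involution. -/
lemma exists_involution_of_even {α : Type*} (s : Finset α) (hs : Even s.card) :
    ∃ σ : α → α, Function.Involutive σ ∧ (∀ x ∈ s, σ x ∈ s ∧ σ x ≠ x) ∧ ∀ x ∉ s, σ x = x := by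
  obtain ⟨k, hk⟩ := hs
  have e : s ≃ Fin k × Bool := Fintype.equivOfCardEq (by simp [hk]; ring)
  let τ : s → s := fun x => e.symm ((e x).1, !(e x).2)
  have hτ : ∀ x, τ (τ x) = x := fun x => by simp [τ]
  have hne : ∀ x, τ x ≠ x := fun x hx => by
    have := congrArg (fun y => (e y).2) hx
    simp [τ] at this
  refine ⟨fun x => if hx : x ∈ s then τ ⟨x, hx⟩ else x, fun x => ?_, fun x hx => ?_,
    fun x hx => by simp [hx]⟩
  · by_cases hx : x ∈ s <;> simp [hx, hτ]
  · simp only [hx, dite_true]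
    exact ⟨Subtype.coe_prop _, fun h => hne ⟨x, hx⟩ (Subtype.ext h)⟩

/-- If a permutation `T` is inverted by an involution `R`, and neither `R` nor `R * T` has a fixed
point in a `T`-invariant set, then `R` moves every `T`-orbit in this set to a different orbit. -/
lemma not_sameCycle_of_inverts {α : Type*} {T R : Equiv.Perm α} {S : Set α}
    (hRT : ∀ (n : ℤ) (x : α), R ((T ^ n) x) = (T ^ (-n)) (R x))
    (hS : ∀ (n : ℤ), ∀ x ∈ S, (T ^ n) x ∈ S)
    (hR : ∀ x ∈ S, R x ≠ x) (hT : ∀ x ∈ S, R x ≠ T x) {x : α} (hx : x ∈ S) :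
    ¬ T.SameCycle x (R x) := by
  rintro ⟨n, hn⟩
  obtain ⟨m, rfl⟩ | ⟨m, rfl⟩ := Int.even_or_odd n
  · apply hR _ (hS m x hx)
    rw [hRT, ← hn, ← Equiv.Perm.mul_apply, ← zpow_add]
    congr 2
    ring
  · apply hT _ (hS m x hx)
    rw [hRT, ← hn, ← Equiv.Perm.mul_apply, ← zpow_add, ← Equiv.Perm.mul_apply, ← zpow_one_add]
    congr 2
    ring

/-- Given, at every vertex `v`, an involution `σ v` preserving the neighbours of `v` in `H` and
fixing none of them, the edges of `H` can be oriented so that an edge entering `v` is paired by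
`σ v` with an edge leaving `v`. -/
lemma exists_orientation (H : SimpleGraph V) (σ : V → V → V)
    (hσ : ∀ v, Function.Involutive (σ v)) (hmem : ∀ u v, H.Adj u v → H.Adj (σ v u) v)
    (hne : ∀ u v, H.Adj u v → σ v u ≠ u) :
    ∃ O : V → V → Prop, (∀ u v, H.Adj u v → (O u v ↔ ¬ O v u)) ∧
      ∀ u v, O u v ↔ O v (σ v u) := by
  let T : Equiv.Perm (V × V) :=
    { toFun := fun d => (d.2, σ d.2 d.1)
      invFun := fun d => (σ d.1 d.2, d.1)
      left_inv := fun d => by simp [hσ d.2 d.1]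
      right_inv := fun d => by simp [hσ d.1 d.2] }
  let R : Equiv.Perm (V × V) := Equiv.prodComm V V
  have hconj : R * T * R⁻¹ = T⁻¹ := by
    ext d <;> rfl
  have hRT : ∀ (n : ℤ) (x : V × V), R ((T ^ n) x) = (T ^ (-n)) (R x) := by
    intro n x
    have : R * T ^ n * R⁻¹ = T ^ (-n) := by rw [← conj_zpow, hconj, inv_zpow, zpow_neg]
    rw [← this]
    simp
  have hS1 : ∀ d : V × V, H.Adj d.1 d.2 ↔ H.Adj (T d).1 (T d).2 := fun d =>
    ⟨fun h => (hmem _ _ h).symm, fun h => by simpa [T, hσ d.2 d.1] using hmem _ _ h.symm⟩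
  have hS : ∀ n : ℤ, ∀ d ∈ {d : V × V | H.Adj d.1 d.2},
      (T ^ n) d ∈ {d : V × V | H.Adj d.1 d.2} := by
    intro n d hd
    induction n with
    | zero => simpa using hd
    | succ n ih =>
      rw [add_comm, zpow_one_add]
      exact (hS1 _).1 ih
    | pred n ih =>
      refine (hS1 _).2 ?_
      rw [← Equiv.Perm.mul_apply, ← zpow_one_add]
      simpa using ih
  let Q := Quotient (Equiv.Perm.SameCycle.setoid T)
  let mk : V × V → Q := Quotient.mk _
  obtain ⟨_, -⟩ := exists_wellFoundedLT Q
  have hmkT : ∀ d, mk (T d) = mk d := fun d =>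
    Quotient.sound (Equiv.Perm.sameCycle_apply_left.2 (Equiv.Perm.SameCycle.refl T d))
  refine ⟨fun u v => mk (u, v) < mk (v, u), fun u v huv => ?_, fun u v => ?_⟩
  · have : mk (u, v) ≠ mk (v, u) := fun h =>
      not_sameCycle_of_inverts (S := {d : V × V | H.Adj d.1 d.2}) hRT hS
        (fun d hd h => hd.ne (congrArg Prod.snd h)) (fun d hd h => hne _ _ hd
          (congrArg Prod.snd h).symm) huv (Quotient.exact h)
    rw [not_lt, le_iff_lt_or_eq, or_iff_left this]
  · have h1 : mk (v, σ v u) = mk (u, v) := hmkT (u, v)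
    have h2 : mk (σ v u, v) = mk (v, u) := by
      rw [← hmkT (σ v u, v)]
      simp [T, hσ v u]
    simp only [h1, h2]

lemma zmod_two_eq_one {x : ZMod 2} (hx : x ≠ 0) : x = 1 := by
  revert x
  decide

/-- A mod-2 cycle on a uniformly locally finite graph meets each vertex in evenly many edges,
which can therefore be paired. -/
lemma exists_pairing {G : SimpleGraph V} (hulf : ULF G) {h : V → V → ZMod 2}
    (hh : h ∈ Zsuf1Z2 G) (v : V) :
    ∃ σ : V → V, Function.Involutive σ ∧ (∀ u, h u v ≠ 0 → h (σ u) v ≠ 0 ∧ σ u ≠ u) := by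
  have hfin := hulf.finite_support hh.1.2 v
  have hsum := hh.2 v
  rw [chainDivZ2, finsum_eq_sum _ hfin, Finset.sum_congr rfl
    (fun u hu => zmod_two_eq_one (hfin.mem_toFinset.1 hu)), Finset.sum_const, nsmul_one,
    ZMod.natCast_eq_zero_iff_even] at hsum
  obtain ⟨σ, hσ, hmem, -⟩ := exists_involution_of_even _ hsum
  exact ⟨σ, hσ, fun u hu => by simpa using hmem u (by simpa using hu)⟩

lemma exists_flow_mod2_eq {G : SimpleGraph V} (hulf : ULF G) {h : V → V → ZMod 2}
    (hh : h ∈ Zsuf1Z2 G) : ∃ f ∈ Zsuf1 G, mod2 f = h := by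
  choose σ hσ hpair using exists_pairing hulf hh
  have hsymm := hh.1.1
  let H : SimpleGraph V :=
    { Adj := fun u v => h u v ≠ 0
      symm := ⟨fun u v huv => by rwa [← hsymm u v]⟩
      loopless := ⟨fun u hu => G.irrefl (hh.1.2 u u hu)⟩ }
  obtain ⟨O, hO, hOσ⟩ := exists_orientation H σ hσ (fun u v huv => (hpair v u huv).1)
    (fun u v huv => (hpair v u huv).2)
  let f : V → V → ℤ := fun u v => if h u v = 0 then 0 else if O u v then 1 else -1
  have hanti : ∀ u v, f u v = - f v u := by
    intro u v
    by_cases huv : h u v = 0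
    · simp [f, huv, (hsymm v u).trans huv]
    · have hvu0 : h v u ≠ 0 := by rwa [hsymm v u]
      have := hO u v huv
      by_cases hvu : O v u <;> simp [f, huv, hvu0, this, hvu]
  have hflip : ∀ v u, f (σ v u) v = - f u v := by
    intro v u
    by_cases huv : h u v = 0
    · have : h (σ v u) v = 0 := by
        by_contra hc
        exact (hpair v _ hc).1 (by rwa [hσ v u])
      simp [f, huv, this]
    · have huv' := (hpair v u huv).1
      rw [hanti]
      simp only [f, hsymm v, huv, huv', if_false, hOσ u v]
  refine ⟨f, ⟨⟨hanti, fun u v huv => hh.1.2 u v fun h0 => huv (by simp [f, h0])⟩,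
    ⟨1, fun u v => by dsimp only [f]; split_ifs <;> simp⟩, fun v => ?_⟩, ?_⟩
  · have : chainDiv f v = - chainDiv f v := by
      conv_lhs => rw [chainDiv, ← finsum_comp_equiv (hσ v).toPerm]
      simp [chainDiv, hflip, finsum_neg_distrib]
    linarith
  · funext u v
    by_cases huv : h u v = 0
    · simp [mod2, f, huv]
    · by_cases hOuv : O u v <;> simp [mod2, f, hOuv, zmod_two_eq_one huv]

lemma mod2_mem_Zsuf1Z2 {G : SimpleGraph V} (hulf : ULF G) {f : V → V → ℤ} (hf : f ∈ Zsuf1 G) :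
    mod2 f ∈ Zsuf1Z2 G := by
  obtain ⟨⟨hanti, hadj⟩, -, hdiv⟩ := hf
  refine ⟨⟨fun u v => ?_, fun u v huv => hadj u v fun h0 => huv (by simp [mod2, h0])⟩,
    fun v => ?_⟩
  · simp [mod2, hanti u v, ZMod.neg_eq_self_mod_two]
  · have := (Int.castAddHom (ZMod 2)).map_finsum (hulf.finite_support hadj v)
    rw [← chainDiv, hdiv v, map_zero] at this
    exact this.symm

lemma OnWalk.of_traversals_ne_zero {G : SimpleGraph V} {u v : V} {p : G.Walk u v} {a b : V}
    (h : traversals p a b ≠ 0) : OnWalk p a b := by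
  obtain ⟨i, hi⟩ := Finset.card_ne_zero.1 h
  rw [Finset.mem_filter, Finset.mem_range] at hi
  exact ⟨i, hi.1, Or.inl hi.2⟩

lemma OnWalk.symm {G : SimpleGraph V} {u v : V} {p : G.Walk u v} {a b : V}
    (h : OnWalk p a b) : OnWalk p b a :=
  h.imp fun _ hi => ⟨hi.1, hi.2.symm⟩

lemma OnWalk.of_walkChain_ne_zero {G : SimpleGraph V} {u v : V} {p : G.Walk u v} {a b : V}
    (h : walkChain p a b ≠ 0) : OnWalk p a b := by
  by_contra hc
  have h1 : traversals p a b = 0 := not_not.1 fun h1 => hc (.of_traversals_ne_zero h1)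
  have h2 : traversals p b a = 0 := not_not.1 fun h2 => hc (OnWalk.of_traversals_ne_zero h2).symm
  simp [walkChain, h1, h2] at h

lemma mod2_circSum {G : SimpleGraph V} {g : Circuit G → ℤ} (hg : ThinCoef G g) :
    mod2 (circSum G g) = circSumZ2 G fun c => (g c : ZMod 2) := by
  funext a b
  have hfin : (Function.support fun c : Circuit G => g c * walkChain c.2 a b).Finite :=
    (hg a b).subset fun c hc =>
      ⟨left_ne_zero_of_mul hc, .of_walkChain_ne_zero (right_ne_zero_of_mul hc)⟩
  refine ((Int.castAddHom (ZMod 2)).map_finsum hfin).trans (finsum_congr fun c => ?_)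
  simp [walkChain, walkChainZ2, CharTwo.sub_eq_add]

lemma mod2_mem_CinfZ2 {G : SimpleGraph V} {f : V → V → ℤ} (hf : f ∈ Cinf G) :
    mod2 f ∈ CinfZ2 G := by
  obtain ⟨r, g, -, hr, hthin, rfl⟩ := Set.mem_iUnion.1 hf
  have hne : ∀ c, (g c : ZMod 2) ≠ 0 → g c ≠ 0 := fun c hc h0 => hc (by simp [h0])
  exact Set.mem_iUnion.2 ⟨r, fun c => (g c : ZMod 2), fun c hc => hr c (hne c hc),
    fun a b => (hthin a b).subset fun c hc => ⟨hne c hc.1, hc.2⟩, mod2_circSum hthin⟩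

/-- mod-2 reduction is a surjection Z^suf_1(X,ℤ) → Z^suf_1(X,ℤ₂)
mapping 𝒞_∞(X,ℤ) into 𝒞_∞(X,ℤ₂); so H^uf_1(X,ℤ₂) is a quotient of H^uf_1(X,ℤ). -/
theorem stmt7 (G : SimpleGraph V) (hulf : ULF G) (hconn : G.Connected) :
    (∀ f ∈ Zsuf1 G, mod2 f ∈ Zsuf1Z2 G) ∧
    (∀ h ∈ Zsuf1Z2 G, ∃ f ∈ Zsuf1 G, mod2 f = h) ∧
    (∀ f ∈ Cinf G, mod2 f ∈ CinfZ2 G) :=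
  ⟨fun _ hf => mod2_mem_Zsuf1Z2 hulf hf, fun _ hh => exists_flow_mod2_eq hulf hh,
    fun _ hf => mod2_mem_CinfZ2 hf⟩

end UFH
end
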